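/- arXiv:cs/0702007 — 3 statements merged into one kernel-verified Lean document; each statement's English description precedes it below -/
import Mathlib

section
/- (KKT sufficiency and uniqueness for (O2).) Suppose R* ∈ ℝ^N and λ* ∈ ℝ^N satisfy: R*_k ≥ 0, λ*_k ≥ 0 and R*_k λ*_k = 0 for every k, and the stationarity equations Σ_{i=k+1}^N (V N_0/d_i)(e^{R*_i} − 1) e^{S*_{i−1}} + (V N_0/d_k) e^{S*_k} = Q_k + λ*_k for every k, where S*_j = R*_1 + ... + R*_j. Then R* is the unique minimizer of F over the nonnegative orthant: for every R ∈ ℝ^N with R_k ≥ 0 for all k and R ≠ R*, F(R) > F(R*). -/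
/-- The sum of the entries of `R` with index less than `j`. -/
noncomputable def partialSum {N : ℕ} (R : Fin N → ℝ) (j : ℕ) : ℝ :=
  ∑ i ∈ Finset.univ.filter (fun i : Fin N => (i : ℕ) < j), R i

theorem partialSum_zero {N : ℕ} (R : Fin N → ℝ) : partialSum R 0 = 0 := by
  simp [partialSum]

theorem partialSum_succ {N : ℕ} (R : Fin N → ℝ) (k : Fin N) :
    partialSum R (k + 1) = partialSum R k + R k := by
  have h : Finset.univ.filter (fun i : Fin N => (i : ℕ) < k + 1) =
      insert k (Finset.univ.filter (fun i : Fin N => (i : ℕ) < k)) := by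
    ext i
    simp only [Finset.mem_filter, Finset.mem_univ, true_and, Finset.mem_insert, Fin.ext_iff]
    omega
  rw [partialSum, h, Finset.sum_insert (by simp), partialSum, add_comm]

theorem sum_filter_lt_eq_partialSum {N : ℕ} (R : Fin N → ℝ) (k : Fin N) :
    ∑ i ∈ Finset.univ.filter (fun i => i < k), R i = partialSum R k := rfl

theorem sum_filter_le_eq_partialSum {N : ℕ} (R : Fin N → ℝ) (k : Fin N) :
    ∑ i ∈ Finset.univ.filter (fun i => i ≤ k), R i = partialSum R (k + 1) := by
  simp only [partialSum, Fin.le_def, Nat.lt_succ_iff]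

theorem sum_mul_sum_filter_gt {N : ℕ} (h g : Fin N → ℝ) :
    ∑ k, (∑ i ∈ Finset.univ.filter (fun i => k < i), g i) * h k = ∑ i, g i * partialSum h i := by
  simp only [partialSum, Finset.sum_mul, Finset.mul_sum, Finset.sum_filter, ite_mul, zero_mul,
    mul_ite, mul_zero, Fin.lt_def]
  exact Finset.sum_comm

/-- Summation by parts against strictly decreasing positive weights. -/
theorem weighted_increments_bound {n : ℕ} (a : Fin (n + 1) → ℝ) (ha : StrictAnti a)
    (hpos : ∀ i, 0 < a i) (D : ℕ → ℝ) (hD0 : D 0 = 0) (hD : ∀ j, 0 ≤ D j) :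
    a (Fin.last n) * D (n + 1) ≤ ∑ i : Fin (n + 1), a i * (D (i + 1) - D i) ∧
      (∑ i : Fin (n + 1), a i * (D (i + 1) - D i) ≤ 0 → ∀ j ≤ n + 1, D j = 0) := by
  induction n with
  | zero =>
    have h0 := hpos 0
    have h1 := hD 1
    rw [Fin.sum_univ_one]
    simp only [Fin.last_zero, Fin.val_zero, zero_add, hD0, sub_zero, le_refl, true_and]
    intro h j hj
    interval_cases j
    · exact hD0
    · nlinarith
  | succ n ih =>
    obtain ⟨hle, hzero⟩ := ih (fun i => a i.castSucc) (fun i j hij => ha (by simpa using hij))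
      (fun i => hpos _)
    have hlt : a (Fin.last (n + 1)) < a (Fin.last n).castSucc :=
      ha (Fin.castSucc_lt_last _)
    have hp := hpos (Fin.last (n + 1))
    have h1 := hD (n + 1)
    have h2 := hD (n + 1 + 1)
    rw [Fin.sum_univ_castSucc]
    simp only [Fin.val_castSucc, Fin.val_last] at *
    have hm := mul_nonneg (sub_nonneg.2 hlt.le) h1
    have hm2 := mul_nonneg hp.le h2
    refine ⟨by linarith, fun h j hj => ?_⟩
    have e1 : D (n + 1) = 0 := by
      have : (a (Fin.last n).castSucc - a (Fin.last (n + 1))) * D (n + 1) = 0 := by linarith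
      exact (mul_eq_zero.1 this).resolve_left (sub_pos.2 hlt).ne'
    have e2 : D (n + 1 + 1) = 0 := by
      have : a (Fin.last (n + 1)) * D (n + 1 + 1) = 0 := by linarith
      exact (mul_eq_zero.1 this).resolve_left hp.ne'
    rw [e1, e2, sub_zero, mul_zero, add_zero] at h
    rcases hj.lt_or_eq with hj | rfl
    · exact hzero h j (by omega)
    · exact e2

/-- The Bregman divergence of the exponential function. -/
noncomputable def expBregman (x y : ℝ) : ℝ :=
  Real.exp x - Real.exp y - Real.exp y * (x - y)

theorem expBregman_pos {x y : ℝ} (h : x ≠ y) : 0 < expBregman x y := by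
  have h1 : expBregman x y = Real.exp y * (Real.exp (x - y) - (x - y + 1)) := by
    rw [expBregman, Real.exp_sub]
    field_simp
    ring
  rw [h1]
  exact mul_pos (Real.exp_pos y) (sub_pos.2 (Real.add_one_lt_exp (sub_ne_zero.2 h)))

theorem expBregman_self (x : ℝ) : expBregman x x = 0 := by
  simp [expBregman]

theorem expBregman_nonneg (x y : ℝ) : 0 ≤ expBregman x y := by
  rcases eq_or_ne x y with rfl | h
  · exact (expBregman_self x).ge
  · exact (expBregman_pos h).le

/-- KKT sufficiency and uniqueness for (O2).  If `(R*, λ*)` satisfies the KKT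
conditions (primal/dual feasibility, complementary slackness, stationarity), then `R*` is the
unique minimizer of `F` over the nonnegative orthant. -/
theorem kkt_implies_unique_minimizer (N : ℕ) (hN : 0 < N) (d : Fin N → ℝ)
    (hd : StrictMono d) (hdpos : ∀ k, 0 < d k)
    (V N0 : ℝ) (hV : 0 < V) (hN0 : 0 < N0) (Q : Fin N → ℝ)
    (Rstar lam : Fin N → ℝ)
    (hRnn : ∀ k, 0 ≤ Rstar k) (hlamnn : ∀ k, 0 ≤ lam k)
    (hcomp : ∀ k, Rstar k * lam k = 0)
    (hstat : ∀ k : Fin N,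
      (∑ i ∈ Finset.univ.filter (fun i => k < i),
          (V * N0 / d i) * (Real.exp (Rstar i) - 1) *
            Real.exp (∑ u ∈ Finset.univ.filter (fun u => u < i), Rstar u)) +
        (V * N0 / d k) *
          Real.exp (∑ i ∈ Finset.univ.filter (fun i => i ≤ k), Rstar i)
        = Q k + lam k) :
    ∀ R : Fin N → ℝ, (∀ k, 0 ≤ R k) → R ≠ Rstar →
      ((∑ k : Fin N, (V * N0 / d k) * (Real.exp (R k) - 1) *
            Real.exp (∑ i ∈ Finset.univ.filter (fun i => i < k), R i)) -
          ∑ k : Fin N, Q k * R k) >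
        ((∑ k : Fin N, (V * N0 / d k) * (Real.exp (Rstar k) - 1) *
            Real.exp (∑ i ∈ Finset.univ.filter (fun i => i < k), Rstar i)) -
          ∑ k : Fin N, Q k * Rstar k) := by
  intro R hR hne
  obtain ⟨n, rfl⟩ : ∃ n, N = n + 1 := ⟨N - 1, by omega⟩
  simp only [sum_filter_lt_eq_partialSum, sum_filter_le_eq_partialSum] at hstat ⊢
  set a : Fin (n + 1) → ℝ := fun k => V * N0 / d k with ha_def
  have hVN : 0 < V * N0 := mul_pos hV hN0
  have ha : StrictAnti a := fun i j hij => div_lt_div_of_pos_left hVN (hdpos i) (hd hij)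
  have hapos : ∀ i, 0 < a i := fun i => div_pos hVN (hdpos i)
  let D : ℕ → ℝ := fun j => expBregman (partialSum R j) (partialSum Rstar j)
  have hpos : 0 < ∑ i : Fin (n + 1), a i * (D (i + 1) - D i) := by
    by_contra! hcon
    have hzero := (weighted_increments_bound a ha hapos D
      (by simp [D, partialSum_zero, expBregman_self]) (fun j => expBregman_nonneg _ _)).2 hcon
    have heq : ∀ j ≤ n + 1, partialSum R j = partialSum Rstar j := fun j hj => by
      by_contra h
      exact (expBregman_pos h).ne' (hzero j hj)
    refine hne (funext fun k => ?_)
    have h1 := heq k (by omega)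
    have h2 := heq (k + 1) (by omega)
    rw [partialSum_succ, partialSum_succ] at h2
    linarith
  let h : Fin (n + 1) → ℝ := fun k => R k - Rstar k
  have hsum : ∀ j, partialSum h j = partialSum R j - partialSum Rstar j := fun j => by
    simp [partialSum, h]
  have hgrad : ∑ k, Q k * h k + ∑ k, lam k * R k =
      ∑ i, (a i * (Real.exp (Rstar i) - 1) * Real.exp (partialSum Rstar i)) * partialSum h i +
        ∑ k, a k * Real.exp (partialSum Rstar (k + 1)) * h k := by
    rw [← sum_mul_sum_filter_gt, ← Finset.sum_add_distrib, ← Finset.sum_add_distrib]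
    refine Finset.sum_congr rfl fun k _ => ?_
    rw [← add_mul, hstat k]
    simp only [h]
    linear_combination hcomp k
  have hlam : 0 ≤ ∑ k, lam k * R k :=
    Finset.sum_nonneg fun k _ => mul_nonneg (hlamnn k) (hR k)
  have hQ : ∑ k, Q k * h k = ∑ k, Q k * R k - ∑ k, Q k * Rstar k := by
    simp [h, mul_sub]
  have hdiff : ∑ i : Fin (n + 1), a i * (D (i + 1) - D i) =
      ∑ k, a k * (Real.exp (R k) - 1) * Real.exp (partialSum R k) -
        ∑ k, a k * (Real.exp (Rstar k) - 1) * Real.exp (partialSum Rstar k) -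
        (∑ i, (a i * (Real.exp (Rstar i) - 1) * Real.exp (partialSum Rstar i)) *
            partialSum h i +
          ∑ k, a k * Real.exp (partialSum Rstar (k + 1)) * h k) := by
    rw [← Finset.sum_add_distrib, ← Finset.sum_sub_distrib, ← Finset.sum_sub_distrib]
    refine Finset.sum_congr rfl fun k _ => ?_
    simp only [D, h, expBregman, hsum, partialSum_succ, Real.exp_add]
    ring
  linarith
end

section
/- Let 1 < k < u ≤ N. For n ∈ {k,…,u} define λ_n = [Q_k(1/d_n − 1/d_u) + Q_u(1/d_k − 1/d_n)]/(1/d_k − 1/d_u) − Q_n (so λ_k = λ_u = 0). Suppose Q_k < [Q_{k−1}(1/d_k − 1/d_{k+1}) + (Q_{k+1} + λ_{k+1})(1/d_{k−1} − 1/d_k)] / (1/d_{k−1} − 1/d_{k+1}). Then: (a) Q_k < [Q_{k−1}(1/d_k − 1/d_u) + Q_u(1/d_{k−1} − 1/d_k)] / (1/d_{k−1} − 1/d_u); (b) setting λ'_n = [Q_{k−1}(1/d_n − 1/d_u) + Q_u(1/d_{k−1} − 1/d_n)]/(1/d_{k−1} − 1/d_u) − Q_n for n ∈ {k−1,…,u},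 one has λ'_k > 0, and for every n ∈ {k+1,…,u−1}, λ'_n − λ_n = ((1/d_n − 1/d_u)/(1/d_k − 1/d_u)) · λ'_k ≥ 0. -/
/-- Strict monotonicity on `{1, …, N}` from monotonicity of consecutive terms. -/
lemma lt_of_forall_lt_succ_of_mem_range {N : ℕ} {d : ℕ → ℝ}
    (hd : ∀ j, 1 ≤ j → j < N → d j < d (j + 1)) {i j : ℕ}
    (hi : 1 ≤ i) (hij : i < j) (hj : j ≤ N) : d i < d j := by
  induction j, hij using Nat.le_induction with
  | base => exact hd i hi (by omega)
  | succ m hm ih => exact (ih (by omega)).trans (hd m (by omega) (by omega))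

/-- If `q` lies below the chord from `(a, p)` to the point at `c` on the chord from `(b, q)` to
`(e, r)`, then `q` lies below the chord from `(a, p)` to `(e, r)`. -/
lemma lt_chord_of_lt_chord_chord {a b c e p q r : ℝ} (hab : b < a) (hbc : c < b) (hce : e ≤ c)
    (h : q < (p * (b - c) + (q * (c - e) + r * (b - c)) / (b - e) * (a - b)) / (a - c)) :
    q < (p * (b - e) + r * (a - b)) / (a - e) := by
  have hbe : 0 < b - e := by linarith
  have hbc' : 0 < b - c := by linarith
  rw [lt_div_iff₀ (by linarith)] at h ⊢
  have h2 := mul_lt_mul_of_pos_right h hbe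
  have h3 : (p * (b - c) + (q * (c - e) + r * (b - c)) / (b - e) * (a - b)) * (b - e) =
      p * (b - c) * (b - e) + (q * (c - e) + r * (b - c)) * (a - b) := by
    field_simp
  rw [h3] at h2
  refine lt_of_mul_lt_mul_right ?_ hbc'.le
  linarith

/-- Two chords ending at `(e, r)` differ by an amount proportional to the distance to `e`. -/
lemma chord_sub_chord {a b e p q r : ℝ} (hae : a - e ≠ 0) (hbe : b - e ≠ 0) (x : ℝ) :
    (p * (x - e) + r * (a - x)) / (a - e) - (q * (x - e) + r * (b - x)) / (b - e) =
      (x - e) / (b - e) * ((p * (b - e) + r * (a - b)) / (a - e) - q) := by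
  field_simp
  ring


/-- deactivating user `k` whose right inactive block is bounded by active user
`u` and whose left neighbor `k−1` is active with zero multiplier: the multipliers only
increase. -/
theorem deactivate_interior_user_left_active (N : ℕ) (d Q : ℕ → ℝ)
    (hd : ∀ j, 1 ≤ j → j < N → d j < d (j + 1))
    (hdpos : ∀ j, 1 ≤ j → j ≤ N → 0 < d j)
    (k u : ℕ) (hk1 : 1 < k) (hku : k < u) (huN : u ≤ N)
    (lam lam' : ℕ → ℝ)
    (hlam : ∀ n, k ≤ n → n ≤ u →
      lam n = (Q k * (1 / d n - 1 / d u) + Q u * (1 / d k - 1 / d n)) /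
        (1 / d k - 1 / d u) - Q n)
    (hlam' : ∀ n, k - 1 ≤ n → n ≤ u →
      lam' n = (Q (k - 1) * (1 / d n - 1 / d u) + Q u * (1 / d (k - 1) - 1 / d n)) /
        (1 / d (k - 1) - 1 / d u) - Q n)
    (hQ : Q k < (Q (k - 1) * (1 / d k - 1 / d (k + 1)) +
        (Q (k + 1) + lam (k + 1)) * (1 / d (k - 1) - 1 / d k)) /
      (1 / d (k - 1) - 1 / d (k + 1))) :
    Q k < (Q (k - 1) * (1 / d k - 1 / d u) + Q u * (1 / d (k - 1) - 1 / d k)) /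
      (1 / d (k - 1) - 1 / d u) ∧
    0 < lam' k ∧
    ∀ n, k + 1 ≤ n → n ≤ u - 1 →
      lam' n - lam n = ((1 / d n - 1 / d u) / (1 / d k - 1 / d u)) * lam' k ∧
      0 ≤ lam' n - lam n := by
  have hinv : ∀ {i j : ℕ}, 1 ≤ i → i < j → j ≤ N → 1 / d j < 1 / d i := fun hi hij hj =>
    one_div_lt_one_div_of_lt (hdpos _ hi (by omega)) (lt_of_forall_lt_succ_of_mem_range hd hi hij hj)
  have hab : 1 / d k < 1 / d (k - 1) := hinv (by omega) (by omega) (by omega)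
  have hbc : 1 / d (k + 1) < 1 / d k := hinv (by omega) (by omega) (by omega)
  have hbe : 1 / d u < 1 / d k := hinv (by omega) hku huN
  have hce : 1 / d u ≤ 1 / d (k + 1) := by
    rcases (Nat.succ_le_of_lt hku).eq_or_lt with h | h
    · exact (congrArg (fun j => 1 / d j) h).ge
    · exact (hinv (by omega) h huN).le
  rw [hlam (k + 1) (by omega) (by omega), add_sub_cancel] at hQ
  have hQk := lt_chord_of_lt_chord_chord hab hbc hce hQ
  have hpos : 0 < lam' k := by
    rw [hlam' k (by omega) (by omega)]
    exact sub_pos.2 hQk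
  refine ⟨hQk, hpos, fun n hkn hnu => ?_⟩
  have hne : 1 / d u < 1 / d n := hinv (by omega) (by omega) huN
  have heq : lam' n - lam n = ((1 / d n - 1 / d u) / (1 / d k - 1 / d u)) * lam' k := by
    rw [hlam' n (by omega) (by omega), hlam n (by omega) (by omega),
      hlam' k (by omega) (by omega), sub_sub_sub_cancel_right]
    exact chord_sub_chord (sub_pos.2 (hbe.trans hab)).ne' (sub_pos.2 hbe).ne' _
  refine ⟨heq, heq ▸ mul_nonneg (div_nonneg ?_ ?_) hpos.le⟩ <;> linarith
end

section
/- Let 1 ≤ v < k < u ≤ N. For n ∈ {v,…,k} define λ_n = [Q_v(1/d_n − 1/d_k) + Q_k(1/d_v − 1/d_n)]/(1/d_v − 1/d_k) − Q_n, and for n ∈ {k,…,u} define λ_n = [Q_k(1/d_n − 1/d_u) + Q_u(1/d_k − 1/d_n)]/(1/d_k − 1/d_u) − Q_n (both formulas give λ_k = 0, and λ_v = λ_u = 0). Suppose Q_k < [(Q_{k−1}+λ_{k−1})(1/d_k − 1/d_{k+1}) + (Q_{k+1}+λ_{k+1})(1/d_{k−1} − 1/d_k)] / (1/d_{k−1}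 − 1/d_{k+1}). Then: (a) Q_k < [Q_v(1/d_k − 1/d_u) + Q_u(1/d_v − 1/d_k)] / (1/d_v − 1/d_u); (b) setting λ'_n = [Q_v(1/d_n − 1/d_u) + Q_u(1/d_v − 1/d_n)]/(1/d_v − 1/d_u) − Q_n for n ∈ {v,…,u}, one has λ'_k > 0; for every n ∈ {v+1,…,k−1}, λ'_n − λ_n = ((1/d_v − 1/d_n)/(1/d_v − 1/d_k)) · λ'_k ≥ 0; and for every n ∈ {k+1,…,u−1}, λ'_n − λ_n = ((1/d_n − 1/d_u)/(1/d_k − 1/d_u)) · λ'_k ≥ 0. -/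
/-- A consecutive increase on `1, …, N` gives strict decrease of the reciprocals. -/
lemma one_div_lt_one_div_of_lt_succ {N : ℕ} {d : ℕ → ℝ}
    (hd : ∀ j, 1 ≤ j → j < N → d j < d (j + 1))
    (hdpos : ∀ j, 1 ≤ j → j ≤ N → 0 < d j) {i j : ℕ} (hi : 1 ≤ i) (hij : i < j)
    (hj : j ≤ N) : 1 / d j < 1 / d i := by
  have hlt : d i < d j := by
    induction j, hij using Nat.le_induction with
    | base => exact hd i hi (by omega)
    | succ m hm ih => exact (ih (by omega)).trans (hd m (by omega) (by omega))
  exact one_div_lt_one_div_of_lt (hdpos i hi (by omega)) hlt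

/-- If the value `z` at `c` lies strictly below the chord joining the points over `p` and `q`
of the piecewise linear function through `(a, x)`, `(c, z)`, `(b, y)`, then it lies strictly
below the chord from `(a, x)` to `(b, y)`. -/
lemma lt_chord_of_lt_inner_chord {a p c q b x z y : ℝ} (hac : c < a) (hpc : c < p) (hcq : q < c)
    (hcb : b < c)
    (h : z < ((x * (p - c) + z * (a - p)) / (a - c) * (c - q) +
      (z * (q - b) + y * (c - q)) / (c - b) * (p - c)) / (p - q)) :
    z < (x * (c - b) + y * (a - c)) / (a - b) := by
  have hac' : 0 < a - c := sub_pos.2 hac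
  have hcb' : 0 < c - b := sub_pos.2 hcb
  rw [lt_div_iff₀ (by linarith)] at h ⊢
  have key : (x * (p - c) + z * (a - p)) / (a - c) * (c - q) +
      (z * (q - b) + y * (c - q)) / (c - b) * (p - c) - z * (p - q) =
      ((p - c) * (c - q) / ((a - c) * (c - b))) *
        (x * (c - b) + y * (a - c) - z * (a - b)) := by
    field_simp
    ring
  have hpos : 0 < (p - c) * (c - q) / ((a - c) * (c - b)) :=
    div_pos (mul_pos (sub_pos.2 hpc) (sub_pos.2 hcq)) (mul_pos hac' hcb')
  have := pos_of_mul_pos_right (key ▸ sub_pos.2 h) hpos.le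
  linarith


/-- deactivating user `k` with inactive blocks on both sides, bounded by active
users `v` and `u`: the multipliers only increase. -/
theorem deactivate_user_two_sided_blocks (N : ℕ) (d Q : ℕ → ℝ)
    (hd : ∀ j, 1 ≤ j → j < N → d j < d (j + 1))
    (hdpos : ∀ j, 1 ≤ j → j ≤ N → 0 < d j)
    (v k u : ℕ) (hv : 1 ≤ v) (hvk : v < k) (hku : k < u) (huN : u ≤ N)
    (lam lam' : ℕ → ℝ)
    (hlam1 : ∀ n, v ≤ n → n ≤ k →
      lam n = (Q v * (1 / d n - 1 / d k) + Q k * (1 / d v - 1 / d n)) /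
        (1 / d v - 1 / d k) - Q n)
    (hlam2 : ∀ n, k ≤ n → n ≤ u →
      lam n = (Q k * (1 / d n - 1 / d u) + Q u * (1 / d k - 1 / d n)) /
        (1 / d k - 1 / d u) - Q n)
    (hlam' : ∀ n, v ≤ n → n ≤ u →
      lam' n = (Q v * (1 / d n - 1 / d u) + Q u * (1 / d v - 1 / d n)) /
        (1 / d v - 1 / d u) - Q n)
    (hQ : Q k < ((Q (k - 1) + lam (k - 1)) * (1 / d k - 1 / d (k + 1)) +
        (Q (k + 1) + lam (k + 1)) * (1 / d (k - 1) - 1 / d k)) /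
      (1 / d (k - 1) - 1 / d (k + 1))) :
    Q k < (Q v * (1 / d k - 1 / d u) + Q u * (1 / d v - 1 / d k)) /
      (1 / d v - 1 / d u) ∧
    0 < lam' k ∧
    (∀ n, v + 1 ≤ n → n ≤ k - 1 →
      lam' n - lam n = ((1 / d v - 1 / d n) / (1 / d v - 1 / d k)) * lam' k ∧
      0 ≤ lam' n - lam n) ∧
    (∀ n, k + 1 ≤ n → n ≤ u - 1 →
      lam' n - lam n = ((1 / d n - 1 / d u) / (1 / d k - 1 / d u)) * lam' k ∧
      0 ≤ lam' n - lam n) := by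
  have anti : ∀ i j, 1 ≤ i → i < j → j ≤ N → 1 / d j < 1 / d i := fun i j hi hij hj =>
    one_div_lt_one_div_of_lt_succ hd hdpos hi hij hj
  have hac := anti v k hv hvk (by omega)
  have hcb := anti k u (by omega) hku huN
  have hchord : Q k < (Q v * (1 / d k - 1 / d u) + Q u * (1 / d v - 1 / d k)) /
      (1 / d v - 1 / d u) := by
    refine lt_chord_of_lt_inner_chord hac (anti (k - 1) k (by omega) (by omega) (by omega))
      (anti k (k + 1) (by omega) (by omega) (by omega)) hcb ?_
    rwa [hlam1 (k - 1) (by omega) (by omega), hlam2 (k + 1) (by omega) (by omega),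
      add_sub_cancel, add_sub_cancel] at hQ
  have hk : 0 < lam' k := by
    rw [hlam' k hvk.le hku.le]
    exact sub_pos.2 hchord
  have hac' : 1 / d v - 1 / d k ≠ 0 := (sub_pos.2 hac).ne'
  have hcb' : 1 / d k - 1 / d u ≠ 0 := (sub_pos.2 hcb).ne'
  have hab' : 1 / d v - 1 / d u ≠ 0 := (sub_pos.2 (hcb.trans hac)).ne'
  refine ⟨hchord, hk, fun n hn hn' => ?_, fun n hn hn' => ?_⟩
  · have heq : lam' n - lam n = ((1 / d v - 1 / d n) / (1 / d v - 1 / d k)) * lam' k := by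
      rw [hlam' n (by omega) (by omega), hlam1 n (by omega) (by omega), hlam' k hvk.le hku.le]
      generalize 1 / d v = a, 1 / d k = c, 1 / d u = b, 1 / d n = t at hac' hcb' hab' ⊢
      field_simp
      ring
    have := anti v n hv (by omega) (by omega)
    exact ⟨heq, heq ▸ mul_nonneg (div_nonneg (sub_pos.2 this).le (sub_pos.2 hac).le) hk.le⟩
  · have heq : lam' n - lam n = ((1 / d n - 1 / d u) / (1 / d k - 1 / d u)) * lam' k := by
      rw [hlam' n (by omega) (by omega), hlam2 n (by omega) (by omega), hlam' k hvk.le hku.le]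
      generalize 1 / d v = a, 1 / d k = c, 1 / d u = b, 1 / d n = t at hac' hcb' hab' ⊢
      field_simp
      ring
    have := anti n u (by omega) (by omega) huN
    exact ⟨heq, heq ▸ mul_nonneg (div_nonneg (sub_pos.2 this).le (sub_pos.2 hcb).le) hk.le⟩
end
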